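/- arXiv:1508.02068 — 2 statements merged into one kernel-verified Lean document; each statement's English description precedes it below -/
import Mathlib

section
/- (Torus invariance of the complex hierarchy.) Assume f, g_1, …, g_m are all 𝕋-invariant, i.e., invariant under z ↦ e^{iθ}z for every θ ∈ ℝ. Then for every d ≥ d^min the 𝕋-invariant relaxations coincide with the ordinary ones: ρ_d^𝕋 = ρ_d and (ρ_d^𝕋)* = ρ_d*. In particular, the supremum of λ ∈ ℝ such that f − λ = Σ_{i=0}^m σ_i g_i with σ_i ∈ Σ_{d−k_i}[z] is unchanged if each σ_i is additionally required to be 𝕋-invariant. -/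
open scoped BigOperators ComplexOrder
open Classical Filter

noncomputable section

/-- Multi-indices in `ℕⁿ`. -/
abbrev MIdx (n : ℕ) := Fin n → ℕ

/-- `|α| = α₁ + ⋯ + αₙ`. -/
def mdeg {n : ℕ} (α : MIdx n) : ℕ := ∑ i, α i

/-- The monomial `z^α := z₁^{α₁} ⋯ zₙ^{αₙ}`. -/
def mpow {n : ℕ} (z : Fin n → ℂ) (α : MIdx n) : ℂ := ∏ i, z i ^ α i

/-- Evaluation of the coefficient array `c` as the (real part of the) complex
polynomial `z ↦ Σ_{α,β} c_{α,β} z̄^α z^β`. -/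
def peval {n : ℕ} (c : MIdx n → MIdx n → ℂ) (z : Fin n → ℂ) : ℝ :=
  (∑ᶠ α : MIdx n, ∑ᶠ β : MIdx n, c α β * (starRingEnd ℂ) (mpow z α) * mpow z β).re

/-- Evaluation of a holomorphic polynomial with coefficients `p`. -/
def hpeval {n : ℕ} (p : MIdx n → ℂ) (z : Fin n → ℂ) : ℂ :=
  ∑ᶠ α : MIdx n, p α * mpow z α

/-- `σ ∈ Σ_d[z]`: `σ` is a finite sum of squared moduli of holomorphic polynomials
of degree at most `d`. -/
def IsSOSUpTo {n : ℕ} (d : ℕ) (σ : (Fin n → ℂ) → ℝ) : Prop :=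
  ∃ (r : ℕ) (p : Fin r → MIdx n → ℂ),
    (∀ j α, p j α ≠ 0 → mdeg α ≤ d) ∧
    ∀ z, σ z = ∑ j, Complex.normSq (hpeval (p j) z)

/-- `σ ∈ Σ[z]`. -/
def IsSOS {n : ℕ} (σ : (Fin n → ℂ) → ℝ) : Prop := ∃ d, IsSOSUpTo d σ

/-- Hermitian coefficient array of degree at most `l` (real-valued complex polynomial). -/
def IsPolyDeg {n : ℕ} (l : ℕ) (c : MIdx n → MIdx n → ℂ) : Prop :=
  (∀ α β, c α β ≠ 0 → mdeg α ≤ l ∧ mdeg β ≤ l) ∧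
  (∀ α β, (starRingEnd ℂ) (c α β) = c β α)

/-- `c` has a nonzero coefficient `c_{α,β}` with `|α| = l` (degree exactly `l`). -/
def HasTopDeg {n : ℕ} (l : ℕ) (c : MIdx n → MIdx n → ℂ) : Prop :=
  ∃ α β, mdeg α = l ∧ mdeg β ≤ l ∧ c α β ≠ 0

/-- Multi-indices of degree at most `e`, indexing moment matrices. -/
def Idx (n e : ℕ) := {α : MIdx n // mdeg α ≤ e}

noncomputable instance {n e : ℕ} : Fintype (Idx n e) :=
  Fintype.ofInjective
    (fun a : Idx n e => (fun i =>
      (⟨a.1 i, Nat.lt_succ_of_le (le_trans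
        (Finset.single_le_sum (f := a.1) (fun j _ => Nat.zero_le _) (Finset.mem_univ i))
        a.2)⟩ : Fin (e + 1)) : Fin n → Fin (e + 1)))
    (fun a b h => Subtype.ext (funext fun i => congrArg Fin.val (congrFun h i)))

/-- Entry `(α,β)` of the localizing matrix `M(φ y)`:
`Σ_{γ,δ} φ_{γ,δ} y_{α+γ, β+δ}`. -/
def momEntry {n : ℕ} (φ y : MIdx n → MIdx n → ℂ) (α β : MIdx n) : ℂ :=
  ∑ᶠ γ : MIdx n, ∑ᶠ δ : MIdx n, φ γ δ * y (α + γ) (β + δ)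

/-- The localizing matrix `M_e(φ y)` indexed by multi-indices of degree at most `e`. -/
def momMatrix (n e : ℕ) (φ y : MIdx n → MIdx n → ℂ) :
    Matrix (Idx n e) (Idx n e) ℂ :=
  Matrix.of fun a b => momEntry φ y a.1 b.1

/-- The moment matrix `M_e(y)` indexed by multi-indices of degree at most `e`. -/
def momMatrixId (n e : ℕ) (y : MIdx n → MIdx n → ℂ) :
    Matrix (Idx n e) (Idx n e) ℂ :=
  Matrix.of fun a b => y a.1 b.1

/-- The Riesz functional `L_y(c) = Σ_{α,β} c_{α,β} y_{α,β}` (real part). -/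
def Ly {n : ℕ} (c y : MIdx n → MIdx n → ℂ) : ℝ :=
  (∑ᶠ α : MIdx n, ∑ᶠ β : MIdx n, c α β * y α β).re

/-- `y ∈ H_d`: hermitian array truncated at degree `d`. -/
def HermArr (n d : ℕ) (y : MIdx n → MIdx n → ℂ) : Prop :=
  ∀ α β : MIdx n, mdeg α ≤ d → mdeg β ≤ d → (starRingEnd ℂ) (y α β) = y β α

/-- The feasible set `K = {z : g_i(z) ≥ 0, i = 1,…,m}`. -/
def Kset {n m : ℕ} (g : Fin m → MIdx n → MIdx n → ℂ) : Set (Fin n → ℂ) :=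
  {z | ∀ i, 0 ≤ peval (g i) z}

/-- Coefficients of the polynomial `s(z) = R² − |z₁|² − ⋯ − |zₙ|²`. -/
def spherePoly (n : ℕ) (R : ℝ) : MIdx n → MIdx n → ℂ := fun α β =>
  if α = 0 ∧ β = 0 then ((R ^ 2 : ℝ) : ℂ)
  else if ∃ i : Fin n, α = Pi.single i 1 ∧ β = Pi.single i 1 then -1 else 0

/-- Feasibility for the complex moment relaxation of order `d`. -/
def MomFeas (n m d : ℕ) (g : Fin m → MIdx n → MIdx n → ℂ) (kk : Fin m → ℕ)
    (y : MIdx n → MIdx n → ℂ) : Prop :=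
  HermArr n d y ∧ y 0 0 = 1 ∧ (momMatrixId n d y).PosSemidef ∧
    ∀ i, (momMatrix n (d - kk i) (g i) y).PosSemidef

/-- `ρ_d`: optimal value of the complex moment relaxation of order `d`. -/
def rhoMom (n m d : ℕ) (f : MIdx n → MIdx n → ℂ) (g : Fin m → MIdx n → MIdx n → ℂ)
    (kk : Fin m → ℕ) : EReal :=
  sInf {x : EReal | ∃ y, MomFeas n m d g kk y ∧ x = ((Ly f y : ℝ) : EReal)}

/-- A degree-`d` sum-of-squares certificate `f − λ = Σ_{i=0}^m σ_i g_i`. -/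
def SOSCert (n m d : ℕ) (f : MIdx n → MIdx n → ℂ) (g : Fin m → MIdx n → MIdx n → ℂ)
    (kk : Fin m → ℕ) (lam : ℝ) : Prop :=
  ∃ (σ0 : (Fin n → ℂ) → ℝ) (σ : Fin m → (Fin n → ℂ) → ℝ),
    IsSOSUpTo d σ0 ∧ (∀ i, IsSOSUpTo (d - kk i) (σ i)) ∧
    ∀ z, peval f z - lam = σ0 z + ∑ i, σ i z * peval (g i) z

/-- `ρ_d*`: optimal value of the complex sum-of-squares relaxation of order `d`. -/
def rhoSOS (n m d : ℕ) (f : MIdx n → MIdx n → ℂ) (g : Fin m → MIdx n → MIdx n → ℂ)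
    (kk : Fin m → ℕ) : EReal :=
  sSup {x : EReal | ∃ lam : ℝ, SOSCert n m d f g kk lam ∧ x = ((lam : ℝ) : EReal)}

/-- `f^opt = inf_K f` as an extended real number. -/
def fOpt (n m : ℕ) (f : MIdx n → MIdx n → ℂ) (g : Fin m → MIdx n → MIdx n → ℂ) : EReal :=
  sInf {x : EReal | ∃ z ∈ Kset g, x = ((peval f z : ℝ) : EReal)}

/-- Sphere assumption: two of the constraint polynomials are `s` and `−s` where
`s(z) = R² − |z₁|² − ⋯ − |zₙ|²`. -/
def SphereAssumption (n m : ℕ) (g : Fin m → MIdx n → MIdx n → ℂ) (R : ℝ) : Prop :=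
  0 < R ∧ ∃ i₁ i₂ : Fin m, i₁ ≠ i₂ ∧ g i₁ = spherePoly n R ∧
    (∀ α β, g i₂ α β = -(spherePoly n R α β))

/-- A function on `ℂⁿ` is invariant under the torus action `z ↦ e^{iθ} z`. -/
def TorusInv {n : ℕ} (σ : (Fin n → ℂ) → ℝ) : Prop :=
  ∀ (θ : ℝ) (z : Fin n → ℂ), σ (fun i => Complex.exp (θ * Complex.I) * z i) = σ z

/-- `A ⪰^𝕋 0`: the quadratic form of `A` is nonnegative on every coefficient vector of
a holomorphic polynomial `p` of degree at most `e` such that `|p|²` is 𝕋-invariant. -/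
def PSDTorus {n e : ℕ} (A : Matrix (Idx n e) (Idx n e) ℂ) : Prop :=
  ∀ p : MIdx n → ℂ, (∀ α, p α ≠ 0 → mdeg α ≤ e) →
    TorusInv (fun z => Complex.normSq (hpeval p z)) →
    0 ≤ (∑ a : Idx n e, ∑ b : Idx n e, (starRingEnd ℂ) (p a.1) * p b.1 * A a b).re

/-- `ρ_d^𝕋`: the 𝕋-invariant moment relaxation of order `d`. -/
def rhoMomT (n m d : ℕ) (f : MIdx n → MIdx n → ℂ) (g : Fin m → MIdx n → MIdx n → ℂ)
    (kk : Fin m → ℕ) : EReal :=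
  sInf {x : EReal | ∃ y, (HermArr n d y ∧ y 0 0 = 1 ∧ PSDTorus (momMatrixId n d y) ∧
    ∀ i, PSDTorus (momMatrix n (d - kk i) (g i) y)) ∧ x = ((Ly f y : ℝ) : EReal)}

/-- `(ρ_d^𝕋)*`: the 𝕋-invariant sum-of-squares relaxation of order `d`. -/
def rhoSOST (n m d : ℕ) (f : MIdx n → MIdx n → ℂ) (g : Fin m → MIdx n → MIdx n → ℂ)
    (kk : Fin m → ℕ) : EReal :=
  sSup {x : EReal | ∃ lam : ℝ,
    (∃ (σ0 : (Fin n → ℂ) → ℝ) (σ : Fin m → (Fin n → ℂ) → ℝ),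
      (IsSOSUpTo d σ0 ∧ TorusInv σ0) ∧
      (∀ i, IsSOSUpTo (d - kk i) (σ i) ∧ TorusInv (σ i)) ∧
      ∀ z, peval f z - lam = σ0 z + ∑ i, σ i z * peval (g i) z) ∧
    x = ((lam : ℝ) : EReal)}


def SS (n l : ℕ) : Finset (MIdx n) := (Finset.univ : Finset (Idx n l)).image (fun a => a.1)

theorem mem_SS {n l : ℕ} {α : MIdx n} : α ∈ SS n l ↔ mdeg α ≤ l := by
  simp only [SS, Finset.mem_image, Finset.mem_univ, true_and]
  constructor
  · rintro ⟨a, rfl⟩; exact a.2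
  · intro h; exact ⟨⟨α, h⟩, rfl⟩

theorem mdeg_add {n : ℕ} (α β : MIdx n) : mdeg (α + β) = mdeg α + mdeg β := by
  simp [mdeg, Finset.sum_add_distrib]

theorem mpow_smul {n : ℕ} (w : ℂ) (z : Fin n → ℂ) (α : MIdx n) :
    mpow (fun i => w * z i) α = w ^ mdeg α * mpow z α := by
  simp [mpow, mdeg, mul_pow, Finset.prod_mul_distrib, Finset.prod_pow_eq_pow_sum]

theorem finsum_SS {n l : ℕ} (F : MIdx n → ℂ) (h : ∀ α, F α ≠ 0 → mdeg α ≤ l) :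
    ∑ᶠ α, F α = ∑ α ∈ SS n l, F α :=
  finsum_eq_sum_of_support_subset _ (fun α hα => by
    simpa [mem_SS] using h α hα)

theorem finsum2_SS {n l : ℕ} (F : MIdx n → MIdx n → ℂ)
    (h : ∀ α β, F α β ≠ 0 → mdeg α ≤ l ∧ mdeg β ≤ l) :
    ∑ᶠ α, ∑ᶠ β, F α β = ∑ α ∈ SS n l, ∑ β ∈ SS n l, F α β := by
  have h1 : ∀ α, ∑ᶠ β, F α β = ∑ β ∈ SS n l, F α β := fun α =>
    finsum_SS _ (fun β hb => (h α β hb).2)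
  rw [finsum_SS (l := l)]
  · exact Finset.sum_congr rfl fun α _ => h1 α
  · intro α hα
    rw [h1] at hα
    obtain ⟨β, _, hb⟩ := Finset.exists_ne_zero_of_sum_ne_zero hα
    exact (h α β hb).1

theorem hpeval_SS {n l : ℕ} (p : MIdx n → ℂ) (h : ∀ α, p α ≠ 0 → mdeg α ≤ l) (z : Fin n → ℂ) :
    hpeval p z = ∑ α ∈ SS n l, p α * mpow z α :=
  finsum_SS _ fun α hα => h α (left_ne_zero_of_mul hα)

theorem momEntry_SS {n l : ℕ} (c y : MIdx n → MIdx n → ℂ) (h : IsPolyDeg l c) (α β : MIdx n) :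
    momEntry c y α β = ∑ γ ∈ SS n l, ∑ δ ∈ SS n l, c γ δ * y (α + γ) (β + δ) :=
  finsum2_SS _ fun γ δ hα => h.1 γ δ (left_ne_zero_of_mul hα)

theorem peval_SS {n l : ℕ} (c : MIdx n → MIdx n → ℂ) (h : IsPolyDeg l c) (z : Fin n → ℂ) :
    ((peval c z : ℝ) : ℂ) =
      ∑ α ∈ SS n l, ∑ β ∈ SS n l, c α β * (starRingEnd ℂ) (mpow z α) * mpow z β := by
  rw [peval, finsum2_SS (l := l)]
  · apply Complex.conj_eq_iff_re.1
    simp only [map_sum, map_mul, Complex.conj_conj, h.2]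
    rw [Finset.sum_comm]
    refine Finset.sum_congr rfl fun α _ => Finset.sum_congr rfl fun β _ => by ring
  · intro α β hα
    exact h.1 α β (left_ne_zero_of_mul (left_ne_zero_of_mul hα))

/-- uniqueness of coefficients -/
theorem coeff_zero {n : ℕ} (s : Finset (MIdx n)) (c : MIdx n → MIdx n → ℂ)
    (h : ∀ z : Fin n → ℂ, ∑ α ∈ s, ∑ β ∈ s, c α β * (starRingEnd ℂ) (mpow z α) * mpow z β = 0)
    (α β : MIdx n) (hα : α ∈ s) (hβ : β ∈ s) : c α β = 0 := by
  let e : MIdx n → MIdx n → (Fin n ⊕ Fin n →₀ ℕ) := fun α β =>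
    Finsupp.equivFunOnFinite.symm (Sum.elim α β)
  have he : ∀ α β α' β', e α β = e α' β' ↔ α = α' ∧ β = β' := by
    intro α β α' β'
    simp only [e, EmbeddingLike.apply_eq_iff_eq]
    constructor
    · intro h
      exact ⟨funext fun i => congrFun h (Sum.inl i), funext fun i => congrFun h (Sum.inr i)⟩
    · rintro ⟨rfl, rfl⟩; rfl
  let P : MvPolynomial (Fin n ⊕ Fin n) ℂ :=
    ∑ α ∈ s, ∑ β ∈ s, MvPolynomial.monomial (e α β) (c α β)
  have hPe : ∀ u v : Fin n → ℂ, MvPolynomial.eval (Sum.elim u v) P =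
      ∑ α ∈ s, ∑ β ∈ s, c α β * mpow u α * mpow v β := by
    intro u v
    simp only [P, map_sum, MvPolynomial.eval_monomial]
    refine Finset.sum_congr rfl fun α _ => Finset.sum_congr rfl fun β _ => ?_
    rw [Finsupp.prod_fintype _ _ (fun i => pow_zero _), Fintype.prod_sum_type]
    simp [e, mpow, mul_assoc]
  let τ : Fin n ⊕ Fin n → MvPolynomial (Fin n ⊕ Fin n) ℂ := Sum.elim
    (fun i => MvPolynomial.X (Sum.inl i) - MvPolynomial.C Complex.I * MvPolynomial.X (Sum.inr i))
    (fun i => MvPolynomial.X (Sum.inl i) + MvPolynomial.C Complex.I * MvPolynomial.X (Sum.inr i))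
  have hQe : ∀ x : Fin n ⊕ Fin n → ℂ, MvPolynomial.eval x (MvPolynomial.bind₁ τ P) =
      MvPolynomial.eval (Sum.elim (fun i => x (Sum.inl i) - Complex.I * x (Sum.inr i))
        (fun i => x (Sum.inl i) + Complex.I * x (Sum.inr i))) P := by
    intro x
    rw [MvPolynomial.eval, MvPolynomial.eval₂Hom_bind₁]
    congr 2
    funext i
    rcases i with i | i <;> simp [τ]
  have hQ : MvPolynomial.bind₁ τ P = 0 := by
    apply MvPolynomial.funext_set (fun _ => Set.range (fun r : ℝ => (r : ℂ)))
      (fun _ => Set.infinite_range_of_injective Complex.ofReal_injective)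
    intro x hx
    have hx' : ∀ i, ∃ r : ℝ, (r : ℂ) = x i := fun i => hx i (Set.mem_univ i)
    choose r hr using hx'
    rw [hQe, hPe, map_zero, ← h (fun i => x (Sum.inl i) + Complex.I * x (Sum.inr i))]
    refine Finset.sum_congr rfl fun α _ => Finset.sum_congr rfl fun β _ => ?_
    congr 2
    simp [mpow, ← hr, sub_eq_add_neg]
  have hP : P = 0 := by
    apply MvPolynomial.funext
    intro x
    have := hQe (Sum.elim (fun i => (x (Sum.inl i) + x (Sum.inr i)) / 2)
      (fun i => Complex.I * (x (Sum.inl i) - x (Sum.inr i)) / 2))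
    rw [hQ, map_zero] at this
    rw [map_zero, this]
    congr 1
    congr 1
    funext i
    rcases i with i | i <;> simp <;> ring_nf <;> simp <;> ring
  have := congrArg (MvPolynomial.coeff (e α β)) hP
  simp only [P, MvPolynomial.coeff_sum, MvPolynomial.coeff_monomial, he, MvPolynomial.coeff_zero] at this
  rw [Finset.sum_eq_single α, Finset.sum_eq_single β] at this
  · simpa using this
  · intro b _ hb; simp [hb]
  · intro hb; exact absurd hβ hb
  · intro b _ hb; simp [hb]
  · intro hb; exact absurd hα hb

theorem inv_coeff {n l : ℕ} (c : MIdx n → MIdx n → ℂ) (h : IsPolyDeg l c)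
    (hi : TorusInv (peval c)) (α β : MIdx n) (hab : mdeg α ≠ mdeg β) : c α β = 0 := by
  by_contra hc
  obtain ⟨ha, hb⟩ := h.1 α β hc
  have hne : ((mdeg β : ℝ) - mdeg α) ≠ 0 := by
    rw [sub_ne_zero]; exact_mod_cast hab.symm
  set θ : ℝ := Real.pi / ((mdeg β : ℝ) - mdeg α) with hθ
  set w := Complex.exp (θ * Complex.I) with hw
  have key := coeff_zero (SS n l)
    (fun α β => c α β * ((starRingEnd ℂ) w ^ mdeg α * w ^ mdeg β - 1)) (fun z => by
      have h1 := congrArg (fun x : ℝ => (x : ℂ)) (hi θ z)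
      simp only [peval_SS c h, ← hw] at h1
      rw [← sub_eq_zero, ← Finset.sum_sub_distrib] at h1
      rw [← h1]
      refine Finset.sum_congr rfl fun α _ => ?_
      rw [← Finset.sum_sub_distrib]
      refine Finset.sum_congr rfl fun β _ => ?_
      rw [mpow_smul, mpow_smul, map_mul, map_pow]
      ring) α β (mem_SS.2 ha) (mem_SS.2 hb)
  have hv : (starRingEnd ℂ) w ^ mdeg α * w ^ mdeg β = -1 := by
    rw [hw, ← Complex.exp_conj, ← Complex.exp_nat_mul, ← Complex.exp_nat_mul, ← Complex.exp_add,
      ← Complex.exp_pi_mul_I]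
    congr 1
    have : (Real.pi : ℂ) = θ * (mdeg β - mdeg α) := by
      have : Real.pi = θ * (mdeg β - mdeg α) := by rw [hθ]; field_simp
      exact_mod_cast congrArg (fun x : ℝ => (x : ℂ)) this
    rw [this]
    simp
    ring
  simp only [hv] at key
  rcases mul_eq_zero.1 key with h | h
  · exact hc h
  · norm_num at h

/-- homogeneous component -/
def hcomp {n : ℕ} (p : MIdx n → ℂ) (l : ℕ) : MIdx n → ℂ := fun α => if mdeg α = l then p α else 0

theorem hcomp_deg {n d : ℕ} (p : MIdx n → ℂ) (l : ℕ) (h : ∀ α, p α ≠ 0 → mdeg α ≤ d) :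
    ∀ α, hcomp p l α ≠ 0 → mdeg α ≤ d := by
  intro α hα
  apply h
  intro h0
  apply hα
  simp [hcomp, h0]

theorem hcomp_eval {n : ℕ} (p : MIdx n → ℂ) (l : ℕ) (w : ℂ) (z : Fin n → ℂ) :
    hpeval (hcomp p l) (fun i => w * z i) = w ^ l * hpeval (hcomp p l) z := by
  have h : ∀ α, hcomp p l α ≠ 0 → mdeg α ≤ l := by
    intro α hα
    by_contra h
    exact hα (if_neg (by omega))
  rw [hpeval_SS _ h, hpeval_SS _ h, Finset.mul_sum]
  refine Finset.sum_congr rfl fun α _ => ?_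
  rw [mpow_smul]
  by_cases h : mdeg α = l
  · rw [h]; ring
  · simp [hcomp, h]

theorem hcomp_inv {n : ℕ} (p : MIdx n → ℂ) (l : ℕ) :
    TorusInv (fun z => Complex.normSq (hpeval (hcomp p l) z)) := by
  intro θ z
  simp only [hcomp_eval, map_mul, map_pow]
  rw [Complex.normSq_eq_norm_sq (Complex.exp _), Complex.norm_exp_ofReal_mul_I]
  simp

theorem hpeval_sum {n d : ℕ} (p : MIdx n → ℂ) (h : ∀ α, p α ≠ 0 → mdeg α ≤ d) (z : Fin n → ℂ) :
    hpeval p z = ∑ l ∈ Finset.range (d + 1), hpeval (hcomp p l) z := by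
  simp only [hpeval_SS p h, fun l => hpeval_SS _ (hcomp_deg p l h)]
  rw [Finset.sum_comm]
  refine Finset.sum_congr rfl fun α hα => ?_
  rw [mem_SS] at hα
  rw [Finset.sum_eq_single (mdeg α)]
  · simp [hcomp]
  · intro b _ hb; simp [hcomp, hb.symm]
  · intro hb; simp at hb; omega

theorem fourier_avg (N : ℕ) (hN : 0 < N) (a : ℕ → ℂ) :
    ∑ j ∈ Finset.range N, Complex.normSq
      (∑ l ∈ Finset.range N, Complex.exp (((2 * Real.pi * j / N : ℝ) : ℂ) * Complex.I) ^ l * a l)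
      = N * ∑ l ∈ Finset.range N, Complex.normSq (a l) := by
  set w := Complex.exp (2 * Real.pi * Complex.I / N) with hw
  have hp : IsPrimitiveRoot w N := Complex.isPrimitiveRoot_exp N hN.ne'
  have hwj : ∀ j : ℕ, Complex.exp (((2 * Real.pi * j / N : ℝ) : ℂ) * Complex.I) = w ^ j := by
    intro j
    rw [hw, ← Complex.exp_nat_mul]; congr 1; push_cast; ring
  have hw1 : w * (starRingEnd ℂ) w = 1 := by
    rw [Complex.mul_conj, Complex.normSq_eq_norm_sq, hp.norm'_eq_one hN.ne']; simp
  simp only [hwj]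
  apply Complex.ofReal_injective
  push_cast
  simp only [Complex.normSq_eq_conj_mul_self, map_sum, Finset.sum_mul_sum]
  rw [Finset.sum_comm, Finset.mul_sum]
  refine Finset.sum_congr rfl fun l hl => ?_
  rw [Finset.sum_comm, Finset.sum_eq_single l]
  · have : ∀ j : ℕ, (starRingEnd ℂ) ((w ^ j) ^ l * a l) * ((w ^ j) ^ l * a l) =
        (starRingEnd ℂ) (a l) * a l := by
      intro j
      have : (w ^ j) ^ l * (starRingEnd ℂ) ((w ^ j) ^ l) = 1 := by
        rw [map_pow, map_pow, ← mul_pow, ← mul_pow, hw1]; simp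
      rw [map_mul]
      linear_combination ((starRingEnd ℂ) (a l) * a l) * this
    rw [Finset.sum_congr rfl fun j _ => this j, Finset.sum_const, Finset.card_range, nsmul_eq_mul]
  · intro b hb hbl
    set q := (starRingEnd ℂ) w ^ l * w ^ b with hq
    have h1 : q ≠ 1 := by
      intro h
      apply hbl
      apply hp.pow_inj (Finset.mem_range.1 hb) (Finset.mem_range.1 hl)
      have : w ^ l * (starRingEnd ℂ) w ^ l = 1 := by rw [← mul_pow, hw1, one_pow]
      linear_combination w ^ l * h - w ^ b * this
    have h2 : q ^ N = 1 := by
      rw [hq, mul_pow, ← pow_mul, ← pow_mul, mul_comm l, mul_comm b, pow_mul, pow_mul, ← map_pow,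
        hp.pow_eq_one]
      simp
    have h3 : ∑ j ∈ Finset.range N, q ^ j = 0 := by
      rw [geom_sum_eq h1, h2]; simp
    have : ∀ j : ℕ, (starRingEnd ℂ) ((w ^ j) ^ l * a l) * ((w ^ j) ^ b * a b) =
        q ^ j * ((starRingEnd ℂ) (a l) * a b) := by
      intro j
      rw [hq, map_mul, map_pow, map_pow]; ring
    simp only [this]
    rw [← Finset.sum_mul, h3, zero_mul]
  · intro h; exact absurd hl h

theorem sos_avg {n d N : ℕ} (hdN : d < N) (σ : (Fin n → ℂ) → ℝ) (h : IsSOSUpTo d σ) :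
    ∃ σ', (IsSOSUpTo d σ' ∧ TorusInv σ') ∧ ∀ z, ∑ j ∈ Finset.range N,
      σ (fun i => Complex.exp (((2 * Real.pi * j / N : ℝ) : ℂ) * Complex.I) * z i) = N * σ' z := by
  obtain ⟨r, p, hp, hs⟩ := h
  have hp' : ∀ j α, p j α ≠ 0 → mdeg α ≤ N - 1 := fun j α h => by
    have := hp j α h; omega
  have hN : N - 1 + 1 = N := by omega
  refine ⟨fun z => ∑ j, ∑ l ∈ Finset.range N, Complex.normSq (hpeval (hcomp (p j) l) z),
    ⟨⟨r * N, fun t => hcomp (p (finProdFinEquiv.symm t).1) (finProdFinEquiv.symm t).2, ?_, ?_⟩, ?_⟩, ?_⟩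
  · intro t
    exact hcomp_deg _ _ (hp _)
  · intro z
    rw [finProdFinEquiv.symm.sum_comp (fun t : Fin r × Fin N =>
      Complex.normSq (hpeval (hcomp (p t.1) t.2) z)), Fintype.sum_prod_type]
    refine Finset.sum_congr rfl fun j _ => ?_
    rw [Finset.sum_range]
  · intro θ z
    refine Finset.sum_congr rfl fun j _ => Finset.sum_congr rfl fun l _ => ?_
    exact hcomp_inv (p j) l θ z
  · intro z
    simp only [hs]
    rw [Finset.sum_comm, Finset.mul_sum]
    refine Finset.sum_congr rfl fun j _ => ?_
    rw [← fourier_avg N (by omega)]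
    refine Finset.sum_congr rfl fun t _ => ?_
    rw [hpeval_sum _ (hp' j), hN]
    simp only [hcomp_eval]

theorem cert_avg (n m d : ℕ) (f : MIdx n → MIdx n → ℂ) (g : Fin m → MIdx n → MIdx n → ℂ)
    (kk : Fin m → ℕ) (hfinv : TorusInv (peval f)) (hginv : ∀ i, TorusInv (peval (g i)))
    (lam : ℝ) (h : SOSCert n m d f g kk lam) :
    ∃ (σ0 : (Fin n → ℂ) → ℝ) (σ : Fin m → (Fin n → ℂ) → ℝ),
      (IsSOSUpTo d σ0 ∧ TorusInv σ0) ∧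
      (∀ i, IsSOSUpTo (d - kk i) (σ i) ∧ TorusInv (σ i)) ∧
      ∀ z, peval f z - lam = σ0 z + ∑ i, σ i z * peval (g i) z := by
  obtain ⟨σ0, σ, h0, hs, he⟩ := h
  obtain ⟨τ0, ht0, ha0⟩ := sos_avg (N := d + 1) (by omega) σ0 h0
  have := fun i => sos_avg (N := d + 1) (by omega) (σ i) (hs i)
  choose τ ht ha using this
  refine ⟨τ0, τ, ht0, ht, fun z => ?_⟩
  have hN : ((d + 1 : ℕ) : ℝ) ≠ 0 := by positivity
  apply mul_left_cancel₀ hN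
  rw [mul_add, ← ha0, Finset.mul_sum]
  simp only [← mul_assoc, ← ha]
  simp only [Finset.sum_mul]
  rw [Finset.sum_comm, ← Finset.sum_add_distrib]
  have : ∀ j ∈ Finset.range (d + 1), peval f z - lam =
      σ0 (fun i => Complex.exp (((2 * Real.pi * j / (d + 1 : ℕ) : ℝ) : ℂ) * Complex.I) * z i) +
      ∑ i, σ i (fun i => Complex.exp (((2 * Real.pi * j / (d + 1 : ℕ) : ℝ) : ℂ) * Complex.I) * z i)
        * peval (g i) z := by
    intro j _
    have := he (fun i => Complex.exp (((2 * Real.pi * j / (d + 1 : ℕ) : ℝ) : ℂ) * Complex.I) * z i)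
    rw [hfinv] at this
    rw [this]
    congr 1
    exact Finset.sum_congr rfl fun i _ => by rw [hginv i]
  rw [← Finset.sum_congr rfl this, Finset.sum_const, Finset.card_range, nsmul_eq_mul]

theorem psd_torus {n e : ℕ} (A : Matrix (Idx n e) (Idx n e) ℂ) (h : A.PosSemidef) : PSDTorus A := by
  intro p _ _
  have := h.dotProduct_mulVec_nonneg (fun a => p a.1)
  have := (Complex.le_def.1 this).1
  simp only [dotProduct, Matrix.mulVec, Finset.mul_sum] at this
  refine le_of_le_of_eq this (congrArg Complex.re ?_)
  refine Finset.sum_congr rfl fun a _ => Finset.sum_congr rfl fun b _ => ?_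
  simp only [Pi.star_apply, starRingEnd_apply]
  ring

theorem torus_psd {n e : ℕ} (A B : Matrix (Idx n e) (Idx n e) ℂ) (hA : A.IsHermitian)
    (hB : ∀ a b, B a b = if mdeg a.1 = mdeg b.1 then A a b else 0)
    (h : PSDTorus A) : B.PosSemidef := by
  have hBh : B.IsHermitian := by
    ext a b
    rw [Matrix.conjTranspose_apply, hB, hB]
    by_cases h : mdeg a.1 = mdeg b.1
    · rw [if_pos h, if_pos h.symm]; exact hA.apply a b
    · rw [if_neg h, if_neg (Ne.symm h)]; simp
  refine Matrix.PosSemidef.of_dotProduct_mulVec_nonneg hBh fun x => ?_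
  rw [Complex.le_def]
  refine ⟨?_, (hBh.im_star_dotProduct_mulVec_self x).symm⟩
  let p : MIdx n → ℂ := fun α => if h : mdeg α ≤ e then x ⟨α, h⟩ else 0
  have hpx : ∀ a : Idx n e, p a.1 = x a := fun a => by simp only [p, dif_pos a.2]; rfl
  have hp : ∀ α, p α ≠ 0 → mdeg α ≤ e := fun α hα => by
    by_contra h; exact hα (dif_neg h)
  have hsum : star x ⬝ᵥ B.mulVec x = ∑ l ∈ Finset.range (e + 1),
      ∑ a : Idx n e, ∑ b : Idx n e,
        (starRingEnd ℂ) (hcomp p l a.1) * hcomp p l b.1 * A a b := by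
    simp only [dotProduct, Matrix.mulVec, Finset.mul_sum]
    rw [Finset.sum_comm]
    refine Eq.trans ?_ Finset.sum_comm.symm
    rw [Finset.sum_comm]
    refine Finset.sum_congr rfl fun a _ => ?_
    refine Eq.trans ?_ Finset.sum_comm.symm
    refine Finset.sum_congr rfl fun b _ => ?_
    rw [Finset.sum_eq_single (mdeg a.1)]
    · rw [hB]
      by_cases h : mdeg a.1 = mdeg b.1
      · simp [hcomp, h, hpx]; ring
      · simp [hcomp, h, Ne.symm h]
    · intro l _ hl; simp [hcomp, hl.symm]
    · intro hl; have := a.2; simp at hl; omega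
  rw [hsum, Complex.re_sum]
  exact Finset.sum_nonneg fun l _ => h _ (hcomp_deg p l hp) (hcomp_inv p l)

theorem mom_avg (n m d k : ℕ) (f : MIdx n → MIdx n → ℂ) (g : Fin m → MIdx n → MIdx n → ℂ)
    (kk : Fin m → ℕ) (hf : IsPolyDeg k f) (hg : ∀ i, IsPolyDeg (kk i) (g i))
    (hfinv : TorusInv (peval f)) (hginv : ∀ i, TorusInv (peval (g i)))
    (hd : ∀ i, kk i ≤ d) (y : MIdx n → MIdx n → ℂ)
    (hy : HermArr n d y ∧ y 0 0 = 1 ∧ PSDTorus (momMatrixId n d y) ∧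
      ∀ i, PSDTorus (momMatrix n (d - kk i) (g i) y)) :
    ∃ y', MomFeas n m d g kk y' ∧ Ly f y' = Ly f y := by
  obtain ⟨h1, h2, h3, h4⟩ := hy
  refine ⟨fun α β => if mdeg α = mdeg β then y α β else 0, ⟨?_, by simpa using h2, ?_, fun i => ?_⟩, ?_⟩
  · intro α β ha hb
    by_cases h : mdeg α = mdeg β
    · simp [h, h1 α β ha hb]
    · simp [h, Ne.symm h]
  · refine torus_psd _ _ ?_ (fun a b => rfl) h3
    ext a b
    exact h1 b.1 a.1 b.2 a.2
  · refine torus_psd _ _ ?_ (fun a b => ?_) (h4 i)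
    · ext a b
      simp only [momMatrix, Matrix.conjTranspose_apply, Matrix.of_apply, momEntry_SS _ _ (hg i)]
      simp only [← starRingEnd_apply, map_sum, map_mul, (hg i).2]
      rw [Finset.sum_comm]
      refine Finset.sum_congr rfl fun γ hγ => Finset.sum_congr rfl fun δ hδ => ?_
      rw [mem_SS] at hγ hδ
      rw [h1]
      · have := hd i; have := b.2; rw [mdeg_add]; omega
      · have := hd i; have := a.2; rw [mdeg_add]; omega
    · simp only [momMatrix, Matrix.of_apply, momEntry_SS _ _ (hg i)]
      have : ∀ γ δ, g i γ δ * (if mdeg (a.1 + γ) = mdeg (b.1 + δ) then y (a.1 + γ) (b.1 + δ) else 0)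
          = if mdeg a.1 = mdeg b.1 then g i γ δ * y (a.1 + γ) (b.1 + δ) else 0 := by
        intro γ δ
        by_cases h : mdeg γ = mdeg δ
        · simp [mdeg_add, h]
        · simp [inv_coeff _ (hg i) (hginv i) γ δ h]
      simp only [this]
      split_ifs <;> simp
  · unfold Ly
    congr 1
    refine finsum_congr fun α => finsum_congr fun β => ?_
    by_cases h : mdeg α = mdeg β
    · simp [h]
    · simp [inv_coeff f hf hfinv α β h]

/-- Torus invariance of the complex hierarchy: if `f` and every `g_i` are 𝕋-invariant,
then for every `d ≥ d^min` the 𝕋-invariant relaxations have the same optimal values as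
the ordinary ones. -/
theorem stmt18 (n m : ℕ) (f : MIdx n → MIdx n → ℂ) (k : ℕ)
    (g : Fin m → MIdx n → MIdx n → ℂ) (kk : Fin m → ℕ)
    (hf : IsPolyDeg k f) (hftop : HasTopDeg k f)
    (hg : ∀ i, IsPolyDeg (kk i) (g i)) (hgtop : ∀ i, HasTopDeg (kk i) (g i))
    (dmin : ℕ) (hdmin : dmin = max k (Finset.univ.sup kk))
    (hK : IsCompact (Kset g))
    (hfinv : TorusInv (peval f)) (hginv : ∀ i, TorusInv (peval (g i))) :
    ∀ d, dmin ≤ d →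
      rhoMomT n m d f g kk = rhoMom n m d f g kk ∧
      rhoSOST n m d f g kk = rhoSOS n m d f g kk := by
  intro d hd
  have hkd : ∀ i, kk i ≤ d := fun i => by
    have := Finset.le_sup (f := kk) (Finset.mem_univ i)
    omega
  constructor
  · unfold rhoMomT rhoMom
    congr 1
    ext x
    constructor
    · rintro ⟨y, hy, rfl⟩
      obtain ⟨y', h, h'⟩ := mom_avg n m d k f g kk hf hg hfinv hginv hkd y hy
      exact ⟨y', h, by rw [h']⟩
    · rintro ⟨y, ⟨h1, h2, h3, h4⟩, rfl⟩
      exact ⟨y, ⟨h1, h2, psd_torus _ h3, fun i => psd_torus _ (h4 i)⟩, rfl⟩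
  · unfold rhoSOST rhoSOS
    congr 1
    ext x
    constructor
    · rintro ⟨lam, ⟨σ0, σ, h0, hs, he⟩, rfl⟩
      exact ⟨lam, ⟨σ0, σ, h0.1, fun i => (hs i).1, he⟩, rfl⟩
    · rintro ⟨lam, h, rfl⟩
      exact ⟨lam, cert_avg n m d f g kk hfinv hginv lam h, rfl⟩
end
end

section
/- (Sign-group invariance of the complex hierarchy.) Assume f, g_1, …, g_m are all {−1,1}-invariant, i.e., f(−z) = f(z) and g_i(−z) = g_i(z) for every z ∈ ℂⁿ. Then for every d ≥ d^min the {−1,1}-invariant relaxations coincide with the ordinary ones: ρ_d^{±1} = ρ_d and (ρ_d^{±1})* = ρ_d*. In particular, the supremum of λ ∈ ℝ such that f − λ = Σ_{i=0}^m σ_i g_i with σ_i ∈ Σ_{d−k_i}[z] is unchanged if each σ_i is additionally required to satisfy σ_i(−z) = σ_i(z). -/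
open scoped BigOperators ComplexOrder
open Classical Filter

noncomputable section

/-- A function on `ℂⁿ` is invariant under the sign action `z ↦ −z`. -/
def SignInv {n : ℕ} (σ : (Fin n → ℂ) → ℝ) : Prop :=
  ∀ z : Fin n → ℂ, σ (-z) = σ z

/-- `A ⪰^{±1} 0`: the quadratic form of `A` is nonnegative on every coefficient vector
of a holomorphic polynomial `p` of degree at most `e` such that `|p|²` is
`{−1,1}`-invariant. -/
def PSDSign {n e : ℕ} (A : Matrix (Idx n e) (Idx n e) ℂ) : Prop :=
  ∀ p : MIdx n → ℂ, (∀ α, p α ≠ 0 → mdeg α ≤ e) →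
    SignInv (fun z => Complex.normSq (hpeval p z)) →
    0 ≤ (∑ a : Idx n e, ∑ b : Idx n e, (starRingEnd ℂ) (p a.1) * p b.1 * A a b).re

/-- `ρ_d^{±1}`: the `{−1,1}`-invariant moment relaxation of order `d`. -/
def rhoMomS (n m d : ℕ) (f : MIdx n → MIdx n → ℂ) (g : Fin m → MIdx n → MIdx n → ℂ)
    (kk : Fin m → ℕ) : EReal :=
  sInf {x : EReal | ∃ y, (HermArr n d y ∧ y 0 0 = 1 ∧ PSDSign (momMatrixId n d y) ∧
    ∀ i, PSDSign (momMatrix n (d - kk i) (g i) y)) ∧ x = ((Ly f y : ℝ) : EReal)}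

/-- `(ρ_d^{±1})*`: the `{−1,1}`-invariant sum-of-squares relaxation of order `d`. -/
def rhoSOSS (n m d : ℕ) (f : MIdx n → MIdx n → ℂ) (g : Fin m → MIdx n → MIdx n → ℂ)
    (kk : Fin m → ℕ) : EReal :=
  sSup {x : EReal | ∃ lam : ℝ,
    (∃ (σ0 : (Fin n → ℂ) → ℝ) (σ : Fin m → (Fin n → ℂ) → ℝ),
      (IsSOSUpTo d σ0 ∧ SignInv σ0) ∧
      (∀ i, IsSOSUpTo (d - kk i) (σ i) ∧ SignInv (σ i)) ∧
      ∀ z, peval f z - lam = σ0 z + ∑ i, σ i z * peval (g i) z) ∧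
    x = ((lam : ℝ) : EReal)}

theorem aux_mdeg_add {n : ℕ} (a b : MIdx n) : mdeg (a + b) = mdeg a + mdeg b := by
  simp [mdeg, Finset.sum_add_distrib]

theorem aux_mpow_neg {n : ℕ} (z : Fin n → ℂ) (α : MIdx n) :
    mpow (-z) α = (-1) ^ mdeg α * mpow z α := by
  unfold mpow mdeg
  rw [← Finset.prod_pow_eq_pow_sum, ← Finset.prod_mul_distrib]
  refine Finset.prod_congr rfl fun i _ => ?_
  rw [Pi.neg_apply, neg_pow]

theorem aux_fsum {n l : ℕ} (F : MIdx n → ℂ) (h : ∀ α, F α ≠ 0 → mdeg α ≤ l) :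
    ∑ᶠ α, F α = ∑ a : Idx n l, F a.1 := by
  let ι : Idx n l ↪ MIdx n := ⟨fun a => a.1, fun a b h => Subtype.ext h⟩
  have h1 : ∑ᶠ α, F α = ∑ α ∈ (Finset.univ : Finset (Idx n l)).map ι, F α := by
    apply finsum_eq_sum_of_support_subset
    intro α hα
    exact Finset.mem_coe.mpr (Finset.mem_map.mpr ⟨⟨α, h α hα⟩, Finset.mem_univ _, rfl⟩)
  rw [h1, Finset.sum_map]
  rfl

theorem aux_dsum {n l : ℕ} (F : MIdx n → MIdx n → ℂ)
    (h : ∀ α β, F α β ≠ 0 → mdeg α ≤ l ∧ mdeg β ≤ l) :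
    ∑ᶠ α, ∑ᶠ β, F α β = ∑ a : Idx n l, ∑ b : Idx n l, F a.1 b.1 := by
  have h1 : ∀ α, ∑ᶠ β, F α β = ∑ b : Idx n l, F α b.1 := fun α =>
    aux_fsum _ fun β hβ => (h α β hβ).2
  simp_rw [h1]
  apply aux_fsum
  intro α hα
  obtain ⟨b, _, hb⟩ := Finset.exists_ne_zero_of_sum_ne_zero hα
  exact (h _ _ hb).1

/-- the exponent of a pair of multi-indices -/
def auxExp {n : ℕ} (α β : MIdx n) : (Fin n ⊕ Fin n) →₀ ℕ :=
  Finsupp.equivFunOnFinite.symm (Sum.elim α β)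

theorem auxExp_inj {n : ℕ} {α β γ δ : MIdx n} (h : auxExp α β = auxExp γ δ) :
    α = γ ∧ β = δ := by
  have h2 := Finsupp.equivFunOnFinite.symm.injective h
  constructor
  · funext i; exact congrFun h2 (Sum.inl i)
  · funext i; exact congrFun h2 (Sum.inr i)

/-- the polynomial in independent variables -/
def auxPoly {n : ℕ} (l : ℕ) (c : MIdx n → MIdx n → ℂ) : MvPolynomial (Fin n ⊕ Fin n) ℂ :=
  ∑ a : Idx n l, ∑ b : Idx n l, MvPolynomial.monomial (auxExp a.1 b.1) (c a.1 b.1)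

theorem auxPoly_eval {n l : ℕ} (c : MIdx n → MIdx n → ℂ) (u : Fin n ⊕ Fin n → ℂ) :
    MvPolynomial.eval u (auxPoly l c) = ∑ a : Idx n l, ∑ b : Idx n l,
      c a.1 b.1 * mpow (fun i => u (Sum.inl i)) a.1 * mpow (fun i => u (Sum.inr i)) b.1 := by
  unfold auxPoly
  rw [map_sum]
  refine Finset.sum_congr rfl fun a _ => ?_
  rw [map_sum]
  refine Finset.sum_congr rfl fun b _ => ?_
  rw [MvPolynomial.eval_monomial, Finsupp.prod_fintype _ _ (by simp), Fintype.prod_sum_type,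
    mul_assoc]
  rfl

theorem auxPoly_coeff {n l : ℕ} (c : MIdx n → MIdx n → ℂ) (a b : Idx n l) :
    MvPolynomial.coeff (auxExp a.1 b.1) (auxPoly l c) = c a.1 b.1 := by
  unfold auxPoly
  rw [MvPolynomial.coeff_sum, Finset.sum_eq_single a, MvPolynomial.coeff_sum,
    Finset.sum_eq_single b]
  · simp
  · intro b' _ hb
    rw [MvPolynomial.coeff_monomial, if_neg]
    intro h
    exact hb (Subtype.ext (auxExp_inj h).2)
  · simp
  · intro a' _ ha
    rw [MvPolynomial.coeff_sum]
    refine Finset.sum_eq_zero fun b' _ => ?_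
    rw [MvPolynomial.coeff_monomial, if_neg]
    intro h
    exact ha (Subtype.ext (auxExp_inj h).1)
  · simp

theorem aux_zero {n l : ℕ} (c : MIdx n → MIdx n → ℂ)
    (h : ∀ z : Fin n → ℂ, ∑ a : Idx n l, ∑ b : Idx n l,
      c a.1 b.1 * (starRingEnd ℂ) (mpow z a.1) * mpow z b.1 = 0) (a b : Idx n l) :
    c a.1 b.1 = 0 := by
  set P := auxPoly l c with hP
  let S : Fin n ⊕ Fin n → MvPolynomial (Fin n ⊕ Fin n) ℂ :=
    Sum.elim (fun i => MvPolynomial.X (Sum.inl i) - MvPolynomial.C Complex.I *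
        MvPolynomial.X (Sum.inr i))
      (fun i => MvPolynomial.X (Sum.inl i) + MvPolynomial.C Complex.I *
        MvPolynomial.X (Sum.inr i))
  have hQ : ∀ x, MvPolynomial.eval x (MvPolynomial.bind₁ S P)
      = MvPolynomial.eval (fun i => MvPolynomial.eval x (S i)) P := by
    intro x
    exact MvPolynomial.eval₂Hom_bind₁ _ _ _ _
  have hQ0 : MvPolynomial.bind₁ S P = 0 := by
    apply MvPolynomial.funext_set (fun _ => Set.range (fun r : ℝ => (r : ℂ)))
    · intro _
      exact Set.infinite_range_of_injective Complex.ofReal_injective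
    · intro x hx
      have hx' : ∀ i, ∃ r : ℝ, (r : ℂ) = x i := fun i => hx i (Set.mem_univ i)
      choose r hr using hx'
      rw [hQ, map_zero, hP, auxPoly_eval]
      rw [← h (fun i => x (Sum.inl i) + Complex.I * x (Sum.inr i))]
      refine Finset.sum_congr rfl fun a _ => Finset.sum_congr rfl fun b _ => ?_
      have e1 : mpow (fun i => MvPolynomial.eval x (S (Sum.inl i))) a.1 =
          (starRingEnd ℂ) (mpow (fun i => x (Sum.inl i) + Complex.I * x (Sum.inr i)) a.1) := by
        unfold mpow
        rw [map_prod]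
        refine Finset.prod_congr rfl fun i _ => ?_
        simp [S, ← hr, sub_eq_add_neg]
      have e2 : mpow (fun i => MvPolynomial.eval x (S (Sum.inr i))) b.1 =
          mpow (fun i => x (Sum.inl i) + Complex.I * x (Sum.inr i)) b.1 := by
        simp [S]
      rw [e1, e2]
  have hP0 : P = 0 := by
    apply MvPolynomial.funext
    intro u
    have := hQ (Sum.elim (fun i => (u (Sum.inl i) + u (Sum.inr i)) / 2)
      (fun i => (u (Sum.inr i) - u (Sum.inl i)) / (2 * Complex.I)))
    rw [hQ0, map_zero] at this
    rw [map_zero, this]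
    congr 1
    congr 1
    funext i
    have hI := Complex.I_ne_zero
    rcases i with i | i
    · simp only [S, Sum.elim_inl, Sum.elim_inr, map_sub, map_mul, MvPolynomial.eval_X,
        MvPolynomial.eval_C]
      field_simp
      ring
    · simp only [S, Sum.elim_inl, Sum.elim_inr, map_add, map_mul, MvPolynomial.eval_X,
        MvPolynomial.eval_C]
      field_simp
      ring
  rw [← auxPoly_coeff c a b, ← hP, hP0, MvPolynomial.coeff_zero]

theorem aux_odd {n l : ℕ} (c : MIdx n → MIdx n → ℂ) (hc : IsPolyDeg l c)
    (hinv : SignInv (peval c)) (α β : MIdx n) (hodd : ¬ Even (mdeg α + mdeg β)) :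
    c α β = 0 := by
  by_contra hne
  obtain ⟨hα, hβ⟩ := hc.1 α β hne
  let c' : MIdx n → MIdx n → ℂ := fun α β => (1 - (-1) ^ (mdeg α + mdeg β)) * c α β
  have key : ∀ z : Fin n → ℂ, ∑ a : Idx n l, ∑ b : Idx n l,
      c' a.1 b.1 * (starRingEnd ℂ) (mpow z a.1) * mpow z b.1 = 0 := by
    intro z
    have hp : ∀ w, peval c w = (∑ a : Idx n l, ∑ b : Idx n l,
        c a.1 b.1 * (starRingEnd ℂ) (mpow w a.1) * mpow w b.1).re := by
      intro w
      unfold peval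
      rw [aux_dsum (l := l)]
      intro α β h
      apply hc.1 α β
      intro h0
      simp [h0] at h
    have h1 := hinv z
    rw [hp, hp] at h1
    apply Complex.ext
    · rw [Complex.zero_re]
      have : ∑ a : Idx n l, ∑ b : Idx n l,
          c' a.1 b.1 * (starRingEnd ℂ) (mpow z a.1) * mpow z b.1 =
          (∑ a : Idx n l, ∑ b : Idx n l,
            c a.1 b.1 * (starRingEnd ℂ) (mpow z a.1) * mpow z b.1) -
          ∑ a : Idx n l, ∑ b : Idx n l,
            c a.1 b.1 * (starRingEnd ℂ) (mpow (-z) a.1) * mpow (-z) b.1 := by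
        rw [← Finset.sum_sub_distrib]
        refine Finset.sum_congr rfl fun a _ => ?_
        rw [← Finset.sum_sub_distrib]
        refine Finset.sum_congr rfl fun b _ => ?_
        simp only [c', aux_mpow_neg, map_mul, map_pow, map_neg, map_one, pow_add]
        ring
      rw [this, Complex.sub_re, h1, sub_self]
    · rw [Complex.zero_im]
      apply Complex.conj_eq_iff_im.mp
      rw [map_sum]
      simp_rw [map_sum]
      rw [Finset.sum_comm]
      refine Finset.sum_congr rfl fun a _ => Finset.sum_congr rfl fun b _ => ?_
      simp only [c', map_mul, map_pow, map_neg, map_one, map_sub, Complex.conj_conj, hc.2]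
      rw [add_comm (mdeg a.1)]
      ring
  have h0 := aux_zero c' key ⟨α, hα⟩ ⟨β, hβ⟩
  simp only [c'] at h0
  rw [(Nat.not_even_iff_odd.mp hodd).neg_one_pow] at h0
  norm_num at h0
  exact hne h0

theorem aux_hpeval_neg {n : ℕ} (p : MIdx n → ℂ) (z : Fin n → ℂ) :
    hpeval p (-z) = hpeval (fun α => (-1) ^ mdeg α * p α) z := by
  unfold hpeval
  refine finsum_congr fun α => ?_
  rw [aux_mpow_neg]
  ring

theorem aux_hpeval_smul {n : ℕ} (s : ℂ) (p : MIdx n → ℂ) (z : Fin n → ℂ) :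
    hpeval (fun α => s * p α) z = s * hpeval p z := by
  unfold hpeval
  rw [← smul_eq_mul, smul_finsum]
  refine finsum_congr fun α => ?_
  simp [mul_assoc]

theorem aux_signInv {n : ℕ} (p : MIdx n → ℂ) (s : ℂ) (hs : Complex.normSq s = 1)
    (h : ∀ α, p α ≠ 0 → (-1 : ℂ) ^ mdeg α = s) :
    SignInv (fun z => Complex.normSq (hpeval p z)) := by
  intro z
  have : (fun α => (-1) ^ mdeg α * p α) = fun α => s * p α := by
    funext α
    by_cases h0 : p α = 0
    · simp [h0]
    · rw [h α h0]
  show Complex.normSq (hpeval p (-z)) = Complex.normSq (hpeval p z)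
  rw [aux_hpeval_neg, this, aux_hpeval_smul, map_mul, hs, one_mul]

theorem aux_avg {n d : ℕ} (σ : (Fin n → ℂ) → ℝ) (h : IsSOSUpTo d σ) :
    IsSOSUpTo d (fun z => (σ z + σ (-z)) / 2) := by
  obtain ⟨r, p, hp, hσ⟩ := h
  let s : ℂ := ((Real.sqrt (1 / 2) : ℝ) : ℂ)
  have hs : Complex.normSq s = 1 / 2 := by
    rw [Complex.normSq_ofReal, Real.mul_self_sqrt (by norm_num)]
  refine ⟨r + r, Fin.append (fun j α => s * p j α)
    (fun j α => s * ((-1) ^ mdeg α * p j α)), ?_, ?_⟩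
  · intro j
    refine Fin.addCases (fun j α h => ?_) (fun j α h => ?_) j
    · rw [Fin.append_left] at h
      exact hp j α (right_ne_zero_of_mul h)
    · rw [Fin.append_right] at h
      exact hp j α (right_ne_zero_of_mul (right_ne_zero_of_mul h))
  · intro z
    rw [Fin.sum_univ_add]
    simp only [Fin.append_left, Fin.append_right]
    simp only [aux_hpeval_smul s, map_mul, hs, ← aux_hpeval_neg, ← Finset.mul_sum, ← hσ]
    ring

theorem aux_quad {n e : ℕ} (A : Matrix (Idx n e) (Idx n e) ℂ) (x : Idx n e → ℂ) :
    star x ⬝ᵥ (A.mulVec x) = ∑ a : Idx n e, ∑ b : Idx n e,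
      (starRingEnd ℂ) (x a) * x b * A a b := by
  simp only [dotProduct, Matrix.mulVec, Finset.mul_sum]
  refine Finset.sum_congr rfl fun a _ => Finset.sum_congr rfl fun b _ => ?_
  simp only [Pi.star_apply, starRingEnd_apply]
  ring

theorem aux_psd_sign {n e : ℕ} (A : Matrix (Idx n e) (Idx n e) ℂ) (h : A.PosSemidef) :
    PSDSign A := by
  intro p _ _
  have := h.dotProduct_mulVec_nonneg (fun a => p a.1)
  rw [aux_quad] at this
  exact (Complex.le_def.mp this).1

theorem aux_sign_psd {n e : ℕ} (A B : Matrix (Idx n e) (Idx n e) ℂ) (hA : PSDSign A)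
    (hB : B.IsHermitian)
    (hAB : ∀ a b, B a b = if Even (mdeg a.1 + mdeg b.1) then A a b else 0) :
    B.PosSemidef := by
  refine .of_dotProduct_mulVec_nonneg hB fun x => ?_
  rw [aux_quad]
  rw [Complex.le_def]
  constructor
  · let pe : MIdx n → ℂ := fun α =>
      if h : mdeg α ≤ e then (if Even (mdeg α) then x ⟨α, h⟩ else 0) else 0
    let po : MIdx n → ℂ := fun α =>
      if h : mdeg α ≤ e then (if Even (mdeg α) then 0 else x ⟨α, h⟩) else 0
    have h1 := hA pe (fun α h => by by_contra h'; simp [pe, h'] at h)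
      (aux_signInv pe 1 (by simp) (fun α h => by
        have : Even (mdeg α) := by by_contra h'; simp [pe, h'] at h
        exact this.neg_one_pow))
    have h2 := hA po (fun α h => by by_contra h'; simp [po, h'] at h)
      (aux_signInv po (-1) (by simp) (fun α h => by
        have : ¬ Even (mdeg α) := by intro h'; simp [po, h'] at h
        exact (Nat.not_even_iff_odd.mp this).neg_one_pow))
    have : ∑ a : Idx n e, ∑ b : Idx n e, (starRingEnd ℂ) (x a) * x b * B a b =
        (∑ a : Idx n e, ∑ b : Idx n e, (starRingEnd ℂ) (pe a.1) * pe b.1 * A a b) +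
        ∑ a : Idx n e, ∑ b : Idx n e, (starRingEnd ℂ) (po a.1) * po b.1 * A a b := by
      rw [← Finset.sum_add_distrib]
      refine Finset.sum_congr rfl fun a _ => ?_
      rw [← Finset.sum_add_distrib]
      refine Finset.sum_congr rfl fun b _ => ?_
      have ea : ∀ a : Idx n e, pe a.1 = if Even (mdeg a.1) then x a else 0 := by
        intro a
        simp only [pe, dif_pos a.2]
        rfl
      have eb : ∀ a : Idx n e, po a.1 = if Even (mdeg a.1) then 0 else x a := by
        intro a
        simp only [po, dif_pos a.2]
        rfl
      rw [hAB, ea, ea, eb, eb]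
      by_cases ha : Even (mdeg a.1) <;> by_cases hb : Even (mdeg b.1) <;>
        simp [ha, hb, Nat.even_add]
    rw [this, Complex.add_re]
    exact add_nonneg h1 h2
  · rw [Complex.zero_im, eq_comm]
    apply Complex.conj_eq_iff_im.mp
    rw [map_sum]
    simp_rw [map_sum]
    rw [Finset.sum_comm]
    refine Finset.sum_congr rfl fun a _ => Finset.sum_congr rfl fun b _ => ?_
    rw [← hB.apply a b]
    simp only [map_mul, starRingEnd_apply, star_star]
    ring

/-- even part of an array -/
def auxEven {n : ℕ} (y : MIdx n → MIdx n → ℂ) : MIdx n → MIdx n → ℂ := fun α β =>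
  if Even (mdeg α + mdeg β) then y α β else 0

theorem auxEven_herm {n d : ℕ} (y : MIdx n → MIdx n → ℂ) (h : HermArr n d y) :
    HermArr n d (auxEven y) := by
  intro α β ha hb
  unfold auxEven
  rw [add_comm (mdeg β)]
  split_ifs
  · exact h α β ha hb
  · simp

theorem aux_momEntry {n l : ℕ} (c y : MIdx n → MIdx n → ℂ) (hc : IsPolyDeg l c)
    (hinv : SignInv (peval c)) (α β : MIdx n) :
    momEntry c (auxEven y) α β = if Even (mdeg α + mdeg β) then momEntry c y α β else 0 := by
  have : ∀ γ δ, c γ δ * auxEven y (α + γ) (β + δ) =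
      if Even (mdeg α + mdeg β) then c γ δ * y (α + γ) (β + δ) else 0 := by
    intro γ δ
    by_cases h : Even (mdeg γ + mdeg δ)
    · have e : Even (mdeg (α + γ) + mdeg (β + δ)) ↔ Even (mdeg α + mdeg β) := by
        rw [aux_mdeg_add, aux_mdeg_add, add_add_add_comm, Nat.even_add]
        simp [h]
      unfold auxEven
      simp only [e]
      split_ifs <;> simp
    · simp [aux_odd c hc hinv γ δ h]
  unfold momEntry
  simp_rw [this]
  split_ifs <;> simp

theorem aux_momHerm {n l e d : ℕ} (c y : MIdx n → MIdx n → ℂ) (hc : IsPolyDeg l c)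
    (hy : HermArr n d y) (hle : e + l ≤ d) : (momMatrix n e c y).IsHermitian := by
  apply Matrix.IsHermitian.ext
  intro a b
  show star (momEntry c y b.1 a.1) = momEntry c y a.1 b.1
  have hs : ∀ α β, momEntry c y α β = ∑ γ : Idx n l, ∑ δ : Idx n l,
      c γ.1 δ.1 * y (α + γ.1) (β + δ.1) := by
    intro α β
    unfold momEntry
    rw [aux_dsum (l := l)]
    intro γ δ h
    exact hc.1 γ δ (left_ne_zero_of_mul h)
  rw [hs, hs, ← starRingEnd_apply, map_sum]
  simp_rw [map_sum]
  rw [Finset.sum_comm]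
  refine Finset.sum_congr rfl fun γ _ => Finset.sum_congr rfl fun δ _ => ?_
  have h1 := a.2
  have h2 := b.2
  have h3 := γ.2
  have h4 := δ.2
  rw [map_mul, hc.2, hy _ _ (by rw [aux_mdeg_add]; omega) (by rw [aux_mdeg_add]; omega)]

theorem aux_Ly {n l : ℕ} (c y : MIdx n → MIdx n → ℂ) (hc : IsPolyDeg l c)
    (hinv : SignInv (peval c)) : Ly c (auxEven y) = Ly c y := by
  unfold Ly
  congr 1
  refine finsum_congr fun α => finsum_congr fun β => ?_
  by_cases h : Even (mdeg α + mdeg β)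
  · simp [auxEven, h]
  · simp [aux_odd c hc hinv α β h]

/-- Sign-group invariance of the complex hierarchy: if `f` and every `g_i` are
`{−1,1}`-invariant, then for every `d ≥ d^min` the `{−1,1}`-invariant relaxations have
the same optimal values as the ordinary ones. -/
theorem stmt19 (n m : ℕ) (f : MIdx n → MIdx n → ℂ) (k : ℕ)
    (g : Fin m → MIdx n → MIdx n → ℂ) (kk : Fin m → ℕ)
    (hf : IsPolyDeg k f) (hftop : HasTopDeg k f)
    (hg : ∀ i, IsPolyDeg (kk i) (g i)) (hgtop : ∀ i, HasTopDeg (kk i) (g i))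
    (dmin : ℕ) (hdmin : dmin = max k (Finset.univ.sup kk))
    (hK : IsCompact (Kset g))
    (hfinv : SignInv (peval f)) (hginv : ∀ i, SignInv (peval (g i))) :
    ∀ d, dmin ≤ d →
      rhoMomS n m d f g kk = rhoMom n m d f g kk ∧
      rhoSOSS n m d f g kk = rhoSOS n m d f g kk := by
  intro d hd
  have hkd : ∀ i, kk i ≤ d := fun i => by
    have := Finset.le_sup (f := kk) (Finset.mem_univ i)
    have h2 := le_max_right k (Finset.univ.sup kk)
    omega
  constructor
  · apply le_antisymm
    · apply sInf_le_sInf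
      rintro x ⟨y, ⟨h1, h2, h3, h4⟩, rfl⟩
      exact ⟨y, ⟨h1, h2, aux_psd_sign _ h3, fun i => aux_psd_sign _ (h4 i)⟩, rfl⟩
    · apply sInf_le_sInf
      rintro x ⟨y, ⟨h1, h2, h3, h4⟩, rfl⟩
      have hh := auxEven_herm y h1
      refine ⟨auxEven y, ⟨hh, ?_, ?_, fun i => ?_⟩, ?_⟩
      · simp [auxEven, h2]
      · refine aux_sign_psd _ _ h3 ?_ (fun a b => rfl)
        apply Matrix.IsHermitian.ext
        intro a b
        exact hh b.1 a.1 b.2 a.2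
      · refine aux_sign_psd _ _ (h4 i) ?_ (fun a b => ?_)
        · exact aux_momHerm _ _ (hg i) hh (by have := hkd i; omega)
        · exact aux_momEntry _ _ (hg i) (hginv i) a.1 b.1
      · rw [aux_Ly f y hf hfinv]
  · apply le_antisymm
    · apply sSup_le_sSup
      rintro x ⟨lam, ⟨σ0, σ, h0, h1, h2⟩, rfl⟩
      exact ⟨lam, ⟨σ0, σ, h0.1, fun i => (h1 i).1, h2⟩, rfl⟩
    · apply sSup_le_sSup
      rintro x ⟨lam, ⟨σ0, σ, h0, h1, h2⟩, rfl⟩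
      refine ⟨lam, ⟨fun z => (σ0 z + σ0 (-z)) / 2, fun i z => (σ i z + σ i (-z)) / 2,
        ⟨aux_avg _ h0, fun z => ?_⟩, fun i => ⟨aux_avg _ (h1 i), fun z => ?_⟩, fun z => ?_⟩, rfl⟩
      · simp only [neg_neg]; ring
      · simp only [neg_neg]; ring
      · have e1 := h2 z
        have e2 := h2 (-z)
        rw [hfinv z] at e2
        have e3 : ∑ i, σ i (-z) * peval (g i) (-z) = ∑ i, σ i (-z) * peval (g i) z :=
          Finset.sum_congr rfl fun i _ => by rw [hginv i z]
        rw [e3] at e2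
        have e4 : ∑ i, (σ i z + σ i (-z)) / 2 * peval (g i) z =
            (∑ i, σ i z * peval (g i) z + ∑ i, σ i (-z) * peval (g i) z) / 2 := by
          rw [← Finset.sum_add_distrib, Finset.sum_div]
          exact Finset.sum_congr rfl fun i _ => by ring
        rw [e4]
        linarith
end
end
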